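/- For every constant integer k ≥ 1, if K_n → ∞, K_n²/P_n → 0, and the edge probability satisfies p_{e,q}(n) = (ln n + (k−1)·ln ln n + α_n)/n for a real sequence α_n with α_n → −∞, then the probability that the minimum degree δ_n of 𝔾_q(n,K_n,P_n,p_n) is at least k converges to 0 as n → ∞. -/

import Mathlib

open Finset Filter

/-- A configuration of the random graph `𝔾_q(n,K,P,p)`: a key-ring assignment
(one finite subset of the key pool `Fin P` per vertex) together with the
on/off states of the channels (one Boolean per unordered pair of vertices). -/
abbrev Config (n P : ℕ) : Type := (Fin n → Finset (Fin P)) × (Sym2 (Fin n) → Bool)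

/-- Probability weight of a configuration: the key rings are independent and
uniform over the `K`-element subsets of the pool of size `P`, and the channels
are independent Bernoulli(`p`). -/
noncomputable def weight (n K P : ℕ) (p : ℝ) (ω : Config n P) : ℝ :=
  (∏ i : Fin n, if (ω.1 i).card = K then ((P.choose K : ℝ))⁻¹ else 0) *
  (∏ e : Sym2 (Fin n), if ω.2 e then p else 1 - p)

/-- Probability of an event in `𝔾_q(n,K,P,p)`. -/
noncomputable def prob (n K P : ℕ) (p : ℝ) (E : Set (Config n P)) : ℝ :=
  ∑ ω : Config n P, Set.indicator E (weight n K P p) ω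

/-- Adjacency in `𝔾_q(n,K,P,p)`: two distinct vertices are adjacent iff their
key rings share at least `q` keys and the channel between them is on. -/
def Adj (q n P : ℕ) (ω : Config n P) (i j : Fin n) : Prop :=
  i ≠ j ∧ q ≤ ((ω.1 i) ∩ (ω.1 j)).card ∧ ω.2 s(i, j) = true

/-- Degree of a vertex. -/
noncomputable def degree (q n P : ℕ) (ω : Config n P) (i : Fin n) : ℕ :=
  Nat.card {j : Fin n // Adj q n P ω i j}

/-- Minimum degree of the graph. -/
noncomputable def minDeg (q n P : ℕ) (ω : Config n P) : ℕ :=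
  sInf (Set.range fun i => degree q n P ω i)

/-- `p_{s,q}`: the probability that two key rings share at least `q` keys. -/
noncomputable def psq (q K P : ℕ) : ℝ :=
  1 - ∑ u ∈ Finset.range q,
    ((K.choose u : ℝ) * ((P - K).choose (K - u) : ℝ)) / (P.choose K : ℝ)

/-- `p_{e,q}`: the probability that two distinct vertices are adjacent. -/
noncomputable def peq (q K P : ℕ) (p : ℝ) : ℝ := p * psq q K P

/-- The law of one key ring. -/
noncomputable def ringWeight (K P : ℕ) (S : Finset (Fin P)) : ℝ :=
  if S.card = K then ((P.choose K : ℝ))⁻¹ else 0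

/-- The law of one channel. -/
noncomputable def channelWeight (p : ℝ) (b : Bool) : ℝ := if b then p else 1 - p

/-- Indicator of the event that two key rings share at least `q` keys. -/
noncomputable def shareInd (q : ℕ) {P : ℕ} (S T : Finset (Fin P)) : ℝ :=
  if q ≤ (S ∩ T).card then 1 else 0

/-- Probability that a random key ring shares at least `q` keys with each of `S` and `T`. -/
noncomputable def jointShare (q K P : ℕ) (S T : Finset (Fin P)) : ℝ :=
  ∑ U, ringWeight K P U * (shareInd q S U * shareInd q T U)

lemma ringWeight_nonneg (K P : ℕ) (S : Finset (Fin P)) : 0 ≤ ringWeight K P S := by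
  unfold ringWeight; split_ifs <;> positivity

lemma channelWeight_nonneg {p : ℝ} (hp : p ∈ Set.Icc (0 : ℝ) 1) (b : Bool) :
    0 ≤ channelWeight p b := by
  unfold channelWeight; split_ifs <;> linarith [hp.1, hp.2]

lemma shareInd_nonneg (q : ℕ) {P : ℕ} (S T : Finset (Fin P)) : 0 ≤ shareInd q S T := by
  unfold shareInd; split_ifs <;> norm_num

lemma jointShare_nonneg (q K P : ℕ) (S T : Finset (Fin P)) : 0 ≤ jointShare q K P S T :=
  Finset.sum_nonneg fun _ _ => mul_nonneg (ringWeight_nonneg _ _ _)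
    (mul_nonneg (shareInd_nonneg _ _ _) (shareInd_nonneg _ _ _))

lemma sum_channelWeight (p : ℝ) : ∑ b, channelWeight p b = 1 := by
  simp [channelWeight]

lemma sum_ringWeight_ite (K P : ℕ) (E : Finset (Fin P) → Prop) [DecidablePred E] :
    ∑ S, ringWeight K P S * (if E S then 1 else 0)
      = ((univ.powersetCard K).filter E).card / (P.choose K : ℝ) := by
  have h : ∀ S : Finset (Fin P), ringWeight K P S * (if E S then 1 else 0)
      = if S ∈ (univ.powersetCard K).filter E then ((P.choose K : ℝ))⁻¹ else 0 := by
    intro S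
    simp only [ringWeight, mem_filter, mem_powersetCard, subset_univ, true_and]
    by_cases h1 : S.card = K <;> by_cases h2 : E S <;> simp [h1, h2]
  rw [Finset.sum_congr rfl fun S _ => h S, Finset.sum_ite_mem]
  simp [div_eq_mul_inv]

lemma sum_ringWeight {K P : ℕ} (h : K ≤ P) : ∑ S, ringWeight K P S = 1 := by
  have := sum_ringWeight_ite K P (fun _ => True)
  have h0 : (P.choose K : ℝ) ≠ 0 := by exact_mod_cast (Nat.choose_pos h).ne'
  simpa [h0] using this

lemma choose_sub_mul_pow_le (t : ℕ) : ∀ {K P : ℕ}, t ≤ K → K ≤ P →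
    (P - t).choose (K - t) * P ^ t ≤ K ^ t * P.choose K := by
  induction t with
  | zero => intro K P _ _; simp
  | succ t ih =>
    intro K P hK hP
    obtain ⟨K, rfl⟩ : ∃ K', K = K' + 1 := ⟨K - 1, by omega⟩
    obtain ⟨P, rfl⟩ : ∃ P', P = P' + 1 := ⟨P - 1, by omega⟩
    have h1 := ih (K := K) (P := P) (by omega) (by omega)
    have h2 := Nat.add_one_mul_choose_eq P K
    have h3 : K * (P + 1) ≤ (K + 1) * P := by nlinarith
    rw [Nat.add_sub_add_right, Nat.add_sub_add_right]
    by_cases hP0 : P = 0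
    · have : K = 0 := by omega
      have : t = 0 := by omega
      subst_vars; simp
    have h4 : (K * (P + 1)) ^ t ≤ ((K + 1) * P) ^ t := Nat.pow_le_pow_left h3 t
    have h5 : 0 < P ^ t := Nat.pow_pos (Nat.pos_of_ne_zero hP0)
    refine Nat.le_of_mul_le_mul_right ?_ h5
    calc (P - t).choose (K - t) * (P + 1) ^ (t + 1) * P ^ t
        = ((P - t).choose (K - t) * P ^ t) * (P + 1) ^ (t + 1) := by ring
      _ ≤ (K ^ t * P.choose K) * (P + 1) ^ (t + 1) := Nat.mul_le_mul_right _ h1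
      _ = (K * (P + 1)) ^ t * ((P + 1) * P.choose K) := by rw [mul_pow]; ring
      _ ≤ ((K + 1) * P) ^ t * ((P + 1) * P.choose K) := Nat.mul_le_mul_right _ h4
      _ = (K + 1) ^ (t + 1) * (P + 1).choose (K + 1) * P ^ t := by
        rw [h2, mul_pow]; ring

lemma sum_ringWeight_superset_le {K P : ℕ} (hK : 1 ≤ K) (hP : K ≤ P) (A : Finset (Fin P)) :
    ∑ S, ringWeight K P S * (if A ⊆ S then 1 else 0) ≤ ((K : ℝ) / P) ^ A.card := by
  rw [sum_ringWeight_ite]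
  have hC : (0 : ℝ) < P.choose K := by exact_mod_cast Nat.choose_pos hP
  have hP0 : (0 : ℝ) < P := by exact_mod_cast (by omega : 0 < P)
  by_cases hA : A.card ≤ K
  · have hcard : ((univ.powersetCard K).filter (A ⊆ ·)).card
        ≤ (P - A.card).choose (K - A.card) := by
      have h1 : (Aᶜ.powersetCard (K - A.card)).card = (P - A.card).choose (K - A.card) := by
        simp [card_powersetCard, card_compl]
      rw [← h1]
      refine Finset.card_le_card_of_injOn (fun S => S \ A) ?_ ?_
      · intro S hS
        simp only [mem_coe, mem_filter, mem_powersetCard, subset_univ, true_and] at hS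
        simp only [mem_coe, mem_powersetCard]
        refine ⟨fun x hx => ?_, ?_⟩
        · simp only [Finset.mem_sdiff] at hx; simpa using hx.2
        · rw [card_sdiff_of_subset hS.2, hS.1]
      · intro S hS T hT hST
        simp only [mem_coe, mem_filter, mem_powersetCard, subset_univ, true_and] at hS hT
        have := congrArg (· ∪ A) hST
        simpa [sdiff_union_of_subset hS.2, sdiff_union_of_subset hT.2] using this
    have h2 := choose_sub_mul_pow_le A.card hA hP
    rw [div_pow, div_le_div_iff₀ hC (by positivity)]
    calc _ ≤ ((P - A.card).choose (K - A.card) : ℝ) * (P : ℝ) ^ A.card := by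
          gcongr
      _ ≤ _ := by exact_mod_cast h2
  · have : (univ.powersetCard K).filter (A ⊆ ·) = ∅ := by
      ext S
      simp only [mem_filter, mem_powersetCard, subset_univ, true_and, notMem_empty, iff_false,
        not_and]
      intro h1 h2
      exact hA (h1 ▸ card_le_card h2)
    rw [this]; simp; positivity

lemma card_powersetCard_filter_inter {K P : ℕ} (T : Finset (Fin P)) (hT : T.card = K) (u : ℕ) :
    ((univ.powersetCard K).filter (fun S => (T ∩ S).card = u)).card
      = K.choose u * (P - K).choose (K - u) := by
  by_cases hu : u ≤ K
  · have h1 : (T.powersetCard u ×ˢ Tᶜ.powersetCard (K - u)).card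
        = K.choose u * (P - K).choose (K - u) := by
      simp [card_powersetCard, card_compl, hT]
    rw [← h1]
    refine Finset.card_nbij' (fun S => (T ∩ S, S \ T)) (fun X => X.1 ∪ X.2) ?_ ?_ ?_ ?_
    · intro S hS
      simp only [mem_coe, mem_filter, mem_powersetCard, subset_univ, true_and] at hS
      simp only [mem_coe, mem_product, mem_powersetCard]
      refine ⟨⟨inter_subset_left, hS.2⟩, fun x hx => ?_, ?_⟩
      · simp only [Finset.mem_sdiff] at hx; simpa using hx.2
      · have := card_sdiff_add_card_inter S T
        rw [inter_comm] at this; omega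
    · rintro ⟨X, Y⟩ h
      simp only [mem_coe, mem_product, mem_powersetCard] at h
      obtain ⟨⟨hX, hXc⟩, hY, hYc⟩ := h
      have hd : Disjoint X Y := disjoint_of_subset_left hX
        (disjoint_of_subset_right hY disjoint_compl_right)
      have hTY : T ∩ Y = ∅ := by
        rw [← disjoint_iff_inter_eq_empty]
        exact disjoint_of_subset_right hY disjoint_compl_right
      simp only [mem_coe, mem_filter, mem_powersetCard, subset_univ, true_and]
      refine ⟨?_, ?_⟩
      · rw [card_union_of_disjoint hd]; omega
      · rw [inter_union_distrib_left, hTY, union_empty, inter_eq_right.2 hX, hXc]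
    · intro S _
      ext x; simp only [mem_union, mem_inter, Finset.mem_sdiff]; tauto
    · rintro ⟨X, Y⟩ h
      simp only [mem_coe, mem_product, mem_powersetCard] at h
      obtain ⟨⟨hX, hXc⟩, hY, hYc⟩ := h
      have hY' : ∀ x ∈ Y, x ∉ T := fun x hx => by simpa using hY hx
      ext x
      · simp only [mem_union, mem_inter]
        exact ⟨fun h => h.2.resolve_right fun h2 => hY' x h2 h.1, fun h => ⟨hX h, Or.inl h⟩⟩
      · simp only [mem_union, Finset.mem_sdiff]
        exact ⟨fun h => h.1.resolve_left fun h2 => h.2 (hX h2), fun h => ⟨Or.inr h, hY' x h⟩⟩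
  · have : (univ.powersetCard K).filter (fun S => (T ∩ S).card = u) = ∅ := by
      ext S
      simp only [mem_filter, mem_powersetCard, subset_univ, true_and, notMem_empty, iff_false,
        not_and]
      intro h1 h2
      have := card_le_card (inter_subset_left (s₁ := T) (s₂ := S))
      omega
    rw [this, Nat.choose_eq_zero_of_lt (by omega)]; simp

lemma sum_ringWeight_inter_card {K P : ℕ} (T : Finset (Fin P)) (hT : T.card = K) (u : ℕ) :
    ∑ S, ringWeight K P S * (if (T ∩ S).card = u then 1 else 0)
      = ((K.choose u : ℝ) * ((P - K).choose (K - u) : ℝ)) / (P.choose K : ℝ) := by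
  rw [sum_ringWeight_ite, card_powersetCard_filter_inter T hT]
  push_cast; rfl

lemma sum_ringWeight_shareInd {q K P : ℕ} (hP : K ≤ P) (T : Finset (Fin P)) (hT : T.card = K) :
    ∑ S, ringWeight K P S * shareInd q T S = psq q K P := by
  unfold psq
  rw [← Finset.sum_congr rfl fun u _ => sum_ringWeight_inter_card T hT u, Finset.sum_comm,
    eq_sub_iff_add_eq, ← Finset.sum_add_distrib]
  refine Eq.trans ?_ (sum_ringWeight hP)
  refine Finset.sum_congr rfl fun S _ => ?_
  rw [← Finset.mul_sum, Finset.sum_ite_eq, ← mul_add]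
  unfold shareInd
  by_cases h : q ≤ (T ∩ S).card
  · simp [h, not_lt.2 h]
  · simp [h, not_le.1 h]

lemma exists_card_eq {K P : ℕ} (hP : K ≤ P) : ∃ T : Finset (Fin P), T.card = K := by
  obtain ⟨T, -, hT⟩ := Finset.exists_subset_card_eq (s := (univ : Finset (Fin P))) (n := K)
    (by simpa using hP)
  exact ⟨T, hT⟩

lemma psq_nonneg {q K P : ℕ} (hP : K ≤ P) : 0 ≤ psq q K P := by
  obtain ⟨T, hT⟩ := exists_card_eq hP
  rw [← sum_ringWeight_shareInd hP T hT]
  exact Finset.sum_nonneg fun S _ => mul_nonneg (ringWeight_nonneg _ _ _) (shareInd_nonneg _ _ _)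

lemma choose_sub_le_add (m : ℕ) : ∀ {N : ℕ} (r : ℕ), m ≤ N → N ≠ 0 →
    N.choose (r + 1) ≤ (N - m).choose (r + 1) + m * (N - 1).choose r := by
  induction m with
  | zero => intros; simp
  | succ m ih =>
    intro N r hm hN
    have h1 := ih (N := N) r (by omega) hN
    obtain ⟨M, hM⟩ : ∃ M, N - m = M + 1 := ⟨N - m - 1, by omega⟩
    have h2 : N - (m + 1) = M := by omega
    have h3 : M.choose r ≤ (N - 1).choose r := Nat.choose_le_choose r (by omega)
    rw [hM, Nat.choose_succ_succ] at h1
    rw [h2]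
    nlinarith

lemma half_choose_le {q K P : ℕ} (hqK : q ≤ K) (hP : 2 * K ^ 2 + 2 * K ≤ P) :
    ((P - q).choose (K - q) : ℝ) ≤ 2 * (P - K).choose (K - q) := by
  rcases Nat.eq_or_lt_of_le hqK with rfl | hlt
  · simp
  obtain ⟨r, hr⟩ : ∃ r, K - q = r + 1 := ⟨K - q - 1, by omega⟩
  have hKP : K ≤ P := by nlinarith
  have h1 := choose_sub_le_add (r + 1) (N := P - q) r (by omega) (by omega)
  have h2 : P - q - (r + 1) = P - K := by omega
  have h3 := Nat.add_one_mul_choose_eq (P - q - 1) r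
  rw [show P - q - 1 + 1 = P - q by omega] at h3
  rw [h2] at h1
  rw [hr]
  have h4 : 2 * (r + 1) * (r + 1) ≤ P - q := by
    have : (r + 1) * (r + 1) ≤ K ^ 2 := by rw [sq]; exact Nat.mul_le_mul (by omega) (by omega)
    have : 2 * (r + 1) * (r + 1) ≤ 2 * K ^ 2 := by nlinarith
    omega
  have h5 : 2 * ((r + 1) * (P - q - 1).choose r) ≤ (P - q).choose (r + 1) := by
    refine Nat.le_of_mul_le_mul_right ?_ (Nat.succ_pos r)
    rw [← h3]
    calc _ = (2 * (r + 1) * (r + 1)) * (P - q - 1).choose r := by rw [Nat.succ_eq_add_one]; ring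
      _ ≤ _ := Nat.mul_le_mul_right _ h4
  have : (P - q).choose (r + 1) ≤ 2 * (P - K).choose (r + 1) := by omega
  exact_mod_cast this

lemma le_psq {q K P : ℕ} (hqK : 2 * q ≤ K) (hK : 1 ≤ K) (hP : 2 * K ^ 2 + 2 * K ≤ P) :
    (1 / (2 * 4 ^ q * q.factorial) : ℝ) * ((K : ℝ) ^ 2 / P) ^ q ≤ psq q K P := by
  have hKP : K ≤ P := by nlinarith
  obtain ⟨T, hT⟩ := exists_card_eq hKP
  have h1 : ((K.choose q : ℝ) * ((P - K).choose (K - q) : ℝ)) / (P.choose K : ℝ) ≤ psq q K P := by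
    rw [← sum_ringWeight_shareInd hKP T hT, ← sum_ringWeight_inter_card T hT]
    refine Finset.sum_le_sum fun S _ => mul_le_mul_of_nonneg_left ?_ (ringWeight_nonneg _ _ _)
    unfold shareInd
    by_cases h : (T ∩ S).card = q
    · simp [h]
    · simp only [h, if_false]; split_ifs <;> norm_num
  refine le_trans ?_ h1
  have hP0 : (0 : ℝ) < P := by exact_mod_cast (by omega : 0 < P)
  have hC : (0 : ℝ) < P.choose K := by exact_mod_cast Nat.choose_pos hKP
  have hC2 : (0 : ℝ) < P.choose q := by exact_mod_cast Nat.choose_pos (by omega : q ≤ P)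
  have hC3 : (0 : ℝ) < (P - q).choose (K - q) := by
    exact_mod_cast Nat.choose_pos (by omega : K - q ≤ P - q)
  have h2 : (P.choose K : ℝ) * K.choose q = P.choose q * (P - q).choose (K - q) := by
    exact_mod_cast Nat.choose_mul (n := P) (k := K) (s := q) (by omega)
  have h3 := half_choose_le (q := q) (K := K) (P := P) (by omega) hP
  have h4 : ((K : ℝ) / 2) ^ q / q.factorial ≤ K.choose q := by
    have := Nat.pow_le_choose (α := ℝ) q K
    refine le_trans ?_ this
    gcongr
    rw [Nat.cast_sub (by omega)]
    have : (2 * q : ℝ) ≤ K := by exact_mod_cast hqK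
    push_cast; linarith
  have h5 : (P.choose q : ℝ) ≤ (P : ℝ) ^ q / q.factorial := Nat.choose_le_pow_div q P
  have hf : (0 : ℝ) < q.factorial := by exact_mod_cast q.factorial_pos
  have h6 : ((K.choose q : ℝ) * ((P - K).choose (K - q) : ℝ)) / (P.choose K : ℝ)
      = (K.choose q : ℝ) ^ 2 * (P - K).choose (K - q) / (P.choose q * (P - q).choose (K - q)) := by
    rw [← h2, div_eq_div_iff hC.ne' (by rw [h2]; positivity)]; ring
  rw [h6, le_div_iff₀ (by positivity)]
  calc (1 / (2 * 4 ^ q * q.factorial) : ℝ) * ((K : ℝ) ^ 2 / P) ^ q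
        * (P.choose q * (P - q).choose (K - q))
      ≤ (1 / (2 * 4 ^ q * q.factorial) : ℝ) * ((K : ℝ) ^ 2 / P) ^ q
        * ((P : ℝ) ^ q / q.factorial * (2 * (P - K).choose (K - q))) := by gcongr
    _ = (((K : ℝ) / 2) ^ q / q.factorial) ^ 2 * (P - K).choose (K - q) := by
      have h4q : (4 : ℝ) ^ q = (2 ^ q) ^ 2 := by
        rw [← pow_mul, mul_comm, pow_mul]; norm_num
      simp only [div_pow, h4q]
      field_simp
      ring
    _ ≤ _ := by gcongr

lemma sum_ringWeight_le_union {K P : ℕ} (hK : 1 ≤ K) (hP : K ≤ P) {ι : Type*} (I : Finset ι)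
    (A : ι → Finset (Fin P)) (t : ℕ) (hA : ∀ i ∈ I, (A i).card = t) (f : Finset (Fin P) → ℝ)
    (hf : ∀ S, f S ≤ ∑ i ∈ I, if A i ⊆ S then (1 : ℝ) else 0) :
    ∑ S, ringWeight K P S * f S ≤ I.card * ((K : ℝ) / P) ^ t := by
  calc ∑ S, ringWeight K P S * f S
      ≤ ∑ S, ∑ i ∈ I, ringWeight K P S * if A i ⊆ S then (1 : ℝ) else 0 := by
        refine Finset.sum_le_sum fun S _ => ?_
        rw [← Finset.mul_sum]
        exact mul_le_mul_of_nonneg_left (hf S) (ringWeight_nonneg _ _ _)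
    _ = ∑ i ∈ I, ∑ S, ringWeight K P S * if A i ⊆ S then (1 : ℝ) else 0 := Finset.sum_comm
    _ ≤ ∑ i ∈ I, ((K : ℝ) / P) ^ t := Finset.sum_le_sum fun i hi => by
        rw [← hA i hi]; exact sum_ringWeight_superset_le hK hP _
    _ = _ := by simp

lemma jointShare_le {q K P : ℕ} (hq : 1 ≤ q) (hK : 1 ≤ K) (hP : K ≤ P) (S T : Finset (Fin P))
    (hS : S.card = K) (hT : T.card = K) :
    jointShare q K P S T ≤ ((K : ℝ) ^ 2 / P) ^ (2 * q)
      + ((K : ℝ) ^ 2 / P) ^ q * ((S ∩ T).card / K) := by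
  classical
  have hK0 : (0 : ℝ) < K := by exact_mod_cast hK
  let I₁ := (S \ T).powersetCard q ×ˢ (T \ S).powersetCard q
  let I₂ := (S ∩ T).sigma fun x => (S.erase x).powersetCard (q - 1)
  let f₁ : Finset (Fin P) → ℝ := fun U => ∑ i ∈ I₁, if i.1 ∪ i.2 ⊆ U then (1 : ℝ) else 0
  let f₂ : Finset (Fin P) → ℝ := fun U => ∑ i ∈ I₂, if insert i.1 i.2 ⊆ U then (1 : ℝ) else 0
  have hone : ∀ {ι : Type} (I : Finset ι) (E : ι → Prop) [DecidablePred E] (i : ι), i ∈ I → E i →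
      (1 : ℝ) ≤ ∑ i ∈ I, if E i then (1 : ℝ) else 0 := by
    intro ι I E _ i hi hE
    calc (1 : ℝ) = if E i then (1 : ℝ) else 0 := by simp [hE]
      _ ≤ _ := Finset.single_le_sum (f := fun i => if E i then (1 : ℝ) else 0)
        (fun j _ => by split_ifs <;> norm_num) hi
  have hf₁0 : ∀ U, 0 ≤ f₁ U := fun U => Finset.sum_nonneg fun i _ => by split_ifs <;> norm_num
  have hf₂0 : ∀ U, 0 ≤ f₂ U := fun U => Finset.sum_nonneg fun i _ => by split_ifs <;> norm_num
  have hcover : ∀ U, shareInd q S U * shareInd q T U ≤ f₁ U + f₂ U := by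
    intro U
    unfold shareInd
    by_cases h1 : q ≤ (S ∩ U).card
    swap
    · simp only [h1, if_false, zero_mul]; linarith [hf₁0 U, hf₂0 U]
    by_cases h2 : q ≤ (T ∩ U).card
    swap
    · simp only [h2, if_false, mul_zero]; linarith [hf₁0 U, hf₂0 U]
    simp only [h1, h2, if_true, mul_one]
    by_cases h3 : ∃ x, x ∈ S ∩ T ∧ x ∈ U
    · obtain ⟨x, hx, hxU⟩ := h3
      have hxS : x ∈ S := (mem_inter.1 hx).1
      have hc : q - 1 ≤ ((S ∩ U).erase x).card := by
        rw [card_erase_of_mem (mem_inter.2 ⟨hxS, hxU⟩)]; omega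
      obtain ⟨A, hA, hAc⟩ := Finset.exists_subset_card_eq hc
      have : (1 : ℝ) ≤ f₂ U := by
        refine hone I₂ (fun i => insert i.1 i.2 ⊆ U) ⟨x, A⟩ ?_ ?_
        · simp only [I₂, mem_sigma, mem_powersetCard]
          exact ⟨hx, hA.trans (erase_subset_erase _ inter_subset_left), hAc⟩
        · exact insert_subset hxU ((hA.trans (erase_subset _ _)).trans inter_subset_right)
      linarith [hf₁0 U]
    · push Not at h3
      obtain ⟨A, hA, hAc⟩ := Finset.exists_subset_card_eq h1
      obtain ⟨B, hB, hBc⟩ := Finset.exists_subset_card_eq h2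
      have : (1 : ℝ) ≤ f₁ U := by
        refine hone I₁ (fun i => i.1 ∪ i.2 ⊆ U) ⟨A, B⟩ ?_ ?_
        · simp only [I₁, mem_product, mem_powersetCard]
          refine ⟨⟨fun x hx => ?_, hAc⟩, fun x hx => ?_, hBc⟩
          · have := mem_inter.1 (hA hx)
            exact Finset.mem_sdiff.2 ⟨this.1, fun h => h3 x (mem_inter.2 ⟨this.1, h⟩) this.2⟩
          · have := mem_inter.1 (hB hx)
            exact Finset.mem_sdiff.2 ⟨this.1, fun h => h3 x (mem_inter.2 ⟨h, this.1⟩) this.2⟩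
        · exact union_subset (hA.trans inter_subset_right) (hB.trans inter_subset_right)
      linarith [hf₂0 U]
  have hb₁ := sum_ringWeight_le_union hK hP I₁ (fun i => i.1 ∪ i.2) (2 * q) (by
    rintro ⟨A, B⟩ h
    simp only [I₁, mem_product, mem_powersetCard] at h
    rw [card_union_of_disjoint (disjoint_of_subset_left h.1.1 (disjoint_of_subset_right h.2.1
      (disjoint_sdiff_sdiff))), h.1.2, h.2.2]; ring) f₁ (fun _ => le_rfl)
  have hb₂ := sum_ringWeight_le_union hK hP I₂ (fun i => insert i.1 i.2) q (by
    rintro ⟨x, A⟩ h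
    simp only [I₂, mem_sigma, mem_powersetCard] at h
    rw [card_insert_of_notMem fun hx => (mem_erase.1 (h.2.1 hx)).1 rfl, h.2.2]; omega)
    f₂ (fun _ => le_rfl)
  have hc₁ : (I₁.card : ℝ) ≤ (K : ℝ) ^ (2 * q) := by
    have : I₁.card ≤ K ^ q * K ^ q := by
      rw [card_product, card_powersetCard, card_powersetCard]
      refine Nat.mul_le_mul ((Nat.choose_le_choose q ?_).trans (Nat.choose_le_pow _ _))
        ((Nat.choose_le_choose q ?_).trans (Nat.choose_le_pow _ _))
      · exact hS ▸ card_le_card sdiff_subset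
      · exact hT ▸ card_le_card sdiff_subset
    rw [two_mul, pow_add]; exact_mod_cast this
  have hc₂ : (I₂.card : ℝ) ≤ (S ∩ T).card * (K : ℝ) ^ (q - 1) := by
    have : I₂.card ≤ ∑ _x ∈ S ∩ T, K ^ (q - 1) := by
      rw [card_sigma]
      refine Finset.sum_le_sum fun x _ => ?_
      rw [card_powersetCard]
      exact (Nat.choose_le_choose _ (hS ▸ card_le_card (erase_subset _ _))).trans
        (Nat.choose_le_pow _ _)
    rw [sum_const, smul_eq_mul] at this
    exact_mod_cast this
  calc jointShare q K P S T
      ≤ ∑ U, (ringWeight K P U * f₁ U + ringWeight K P U * f₂ U) := by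
        refine Finset.sum_le_sum fun U _ => ?_
        rw [← mul_add]
        exact mul_le_mul_of_nonneg_left (hcover U) (ringWeight_nonneg _ _ _)
    _ ≤ I₁.card * ((K : ℝ) / P) ^ (2 * q) + I₂.card * ((K : ℝ) / P) ^ q := by
        rw [Finset.sum_add_distrib]; exact add_le_add hb₁ hb₂
    _ ≤ (K : ℝ) ^ (2 * q) * ((K : ℝ) / P) ^ (2 * q)
        + (S ∩ T).card * (K : ℝ) ^ (q - 1) * ((K : ℝ) / P) ^ q := by gcongr
    _ = _ := by
        have hKq : (K : ℝ) ^ (q - 1) = K ^ q / K := by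
          rw [eq_div_iff hK0.ne', ← pow_succ]; congr 1; omega
        rw [hKq, ← mul_pow, show (K : ℝ) * (K / P) = K ^ 2 / P by ring,
          show (K : ℝ) ^ 2 / P = K * (K / P) by ring, mul_pow _ _ q]
        ring

lemma sum_ringWeight_exp_inter_le {K P : ℕ} (hK : 1 ≤ K) (hP : K ≤ P) (S : Finset (Fin P))
    (hS : S.card = K) {β : ℝ} (hβ : 0 ≤ β) :
    ∑ T, ringWeight K P T * Real.exp (β * (S ∩ T).card)
      ≤ Real.exp ((K : ℝ) ^ 2 / P * Real.exp β) := by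
  classical
  set y := Real.exp β - 1 with hy
  have hy0 : 0 ≤ y := by linarith [Real.add_one_le_exp β]
  have h1 : ∀ T, Real.exp (β * (S ∩ T).card)
      = ∑ A ∈ S.powerset, y ^ A.card * (if A ⊆ T then 1 else 0) := by
    intro T
    have h2 : Real.exp (β * (S ∩ T).card) = (y + 1) ^ (S ∩ T).card := by
      rw [mul_comm, Real.exp_nat_mul]; simp [hy]
    rw [h2, ← Finset.sum_pow_mul_eq_add_pow]
    simp only [one_pow, mul_one, mul_ite, mul_zero]
    rw [← Finset.sum_filter]
    refine Finset.sum_congr ?_ fun _ _ => rfl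
    ext A; rw [mem_powerset, mem_filter, mem_powerset, subset_inter_iff]
  calc ∑ T, ringWeight K P T * Real.exp (β * (S ∩ T).card)
      = ∑ A ∈ S.powerset, y ^ A.card * ∑ T, ringWeight K P T * (if A ⊆ T then 1 else 0) := by
        simp_rw [h1, Finset.mul_sum]
        rw [Finset.sum_comm]
        refine Finset.sum_congr rfl fun A _ => Finset.sum_congr rfl fun T _ => by ring
    _ ≤ ∑ A ∈ S.powerset, y ^ A.card * ((K : ℝ) / P) ^ A.card := by
        gcongr with A _
        exact sum_ringWeight_superset_le hK hP A
    _ = (y * (K / P) + 1) ^ K := by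
        rw [← hS, ← Finset.sum_pow_mul_eq_add_pow]
        simp [mul_pow]
    _ ≤ (Real.exp (y * (K / P))) ^ K := by
        gcongr; exact Real.add_one_le_exp _
    _ = Real.exp ((K : ℝ) ^ 2 / P * y) := by
        rw [← Real.exp_nat_mul]; congr 1; ring
    _ ≤ _ := by
        gcongr; linarith

lemma sum_prod_resample {ι T : Type*} [Fintype ι] [DecidableEq ι] [Fintype T]
    (w : T → ℝ) (hw : ∑ t, w t = 1) (i : ι) (f : (ι → T) → ℝ) :
    ∑ x : ι → T, (∏ j, w (x j)) * f x
      = ∑ x : ι → T, (∏ j, w (x j)) * ∑ t, w t * f (Function.update x i t) := by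
  have hprod : ∀ (x : ι → T) (t : T),
      (∏ j, w (Function.update x i t j)) * w (x i) = (∏ j, w (x j)) * w t := by
    intro x t
    rw [← Finset.mul_prod_erase univ _ (mem_univ i),
      ← Finset.mul_prod_erase univ (fun j => w (x j)) (mem_univ i), Function.update_self]
    have : ∏ j ∈ univ.erase i, w (Function.update x i t j) = ∏ j ∈ univ.erase i, w (x j) :=
      Finset.prod_congr rfl fun j hj => by rw [Function.update_of_ne (ne_of_mem_erase hj)]
    rw [this]; ring
  have h1 : ∑ x : ι → T, (∏ j, w (x j)) * f x
      = ∑ z : (ι → T) × T, (∏ j, w (z.1 j)) * w z.2 * f z.1 := by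
    rw [Fintype.sum_prod_type]
    refine Finset.sum_congr rfl fun x _ => ?_
    dsimp only
    rw [← Finset.sum_mul, ← Finset.mul_sum, hw, mul_one]
  have h2 : ∑ x : ι → T, (∏ j, w (x j)) * ∑ t, w t * f (Function.update x i t)
      = ∑ z : (ι → T) × T, (∏ j, w (z.1 j)) * w z.2 * f (Function.update z.1 i z.2) := by
    rw [Fintype.sum_prod_type]
    refine Finset.sum_congr rfl fun x _ => ?_
    rw [Finset.mul_sum]
    exact Finset.sum_congr rfl fun t _ => by ring
  rw [h1, h2]
  refine Finset.sum_nbij' (fun z => (Function.update z.1 i z.2, z.1 i))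
    (fun z => (Function.update z.1 i z.2, z.1 i)) ?_ ?_ ?_ ?_ ?_
  · simp
  · simp
  · simp
  · simp
  · rintro ⟨x, t⟩ _
    simp only [Function.update_idem, Function.update_eq_self]
    rw [hprod]

/-- Expectation of a random variable in `𝔾_q(n,K,P,p)`. -/
noncomputable def meanOf (n K P : ℕ) (p : ℝ) (f : Config n P → ℝ) : ℝ :=
  ∑ ω : Config n P, weight n K P p ω * f ω

section Expectation

variable {n K P : ℕ} {p : ℝ}

lemma weight_eq (ω : Config n P) :
    weight n K P p ω = (∏ i, ringWeight K P (ω.1 i)) * ∏ e, channelWeight p (ω.2 e) := rfl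

lemma weight_nonneg (hp : p ∈ Set.Icc (0 : ℝ) 1) (ω : Config n P) : 0 ≤ weight n K P p ω := by
  rw [weight_eq]
  exact mul_nonneg (Finset.prod_nonneg fun _ _ => ringWeight_nonneg _ _ _)
    (Finset.prod_nonneg fun _ _ => channelWeight_nonneg hp _)

lemma meanOf_mono (hp : p ∈ Set.Icc (0 : ℝ) 1) {f g : Config n P → ℝ} (h : ∀ ω, f ω ≤ g ω) :
    meanOf n K P p f ≤ meanOf n K P p g :=
  Finset.sum_le_sum fun ω _ => mul_le_mul_of_nonneg_left (h ω) (weight_nonneg hp ω)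

lemma meanOf_add (f g : Config n P → ℝ) :
    meanOf n K P p (fun ω => f ω + g ω) = meanOf n K P p f + meanOf n K P p g := by
  simp [meanOf, mul_add, Finset.sum_add_distrib]

lemma meanOf_sub (f g : Config n P → ℝ) :
    meanOf n K P p (fun ω => f ω - g ω) = meanOf n K P p f - meanOf n K P p g := by
  simp [meanOf, mul_sub, Finset.sum_sub_distrib]

lemma meanOf_const_mul (c : ℝ) (f : Config n P → ℝ) :
    meanOf n K P p (fun ω => c * f ω) = c * meanOf n K P p f := by
  simp only [meanOf, Finset.mul_sum]
  exact Finset.sum_congr rfl fun ω _ => by ring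

lemma meanOf_sum {ι : Type*} (s : Finset ι) (f : ι → Config n P → ℝ) :
    meanOf n K P p (fun ω => ∑ i ∈ s, f i ω) = ∑ i ∈ s, meanOf n K P p (f i) := by
  simp only [meanOf, Finset.mul_sum]
  exact Finset.sum_comm

lemma meanOf_congr {f g : Config n P → ℝ} (h : ∀ ω, (∀ i, (ω.1 i).card = K) → f ω = g ω) :
    meanOf n K P p f = meanOf n K P p g := by
  refine Finset.sum_congr rfl fun ω _ => ?_
  by_cases hω : ∀ i, (ω.1 i).card = K
  · rw [h ω hω]
  · push Not at hω
    obtain ⟨i, hi⟩ := hω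
    have : weight n K P p ω = 0 := by
      rw [weight_eq, Finset.prod_eq_zero (mem_univ i) (by simp [ringWeight, hi]), zero_mul]
    simp [this]

lemma meanOf_one (hK : K ≤ P) : meanOf n K P p (fun _ => 1) = 1 := by
  have h1 : ∑ x : Fin n → Finset (Fin P), ∏ i, ringWeight K P (x i) = 1 := by
    rw [← Fintype.piFinset_univ, ← Finset.prod_univ_sum]; simp [sum_ringWeight hK]
  have h2 : ∑ x : Sym2 (Fin n) → Bool, ∏ e, channelWeight p (x e) = 1 := by
    rw [← Fintype.piFinset_univ, ← Finset.prod_univ_sum, sum_channelWeight]; simp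
  simp only [meanOf, weight_eq, mul_one]
  rw [Fintype.sum_prod_type]
  simp only [← Finset.mul_sum, h2, mul_one, h1]

lemma meanOf_resample_ring (hK : K ≤ P) (j : Fin n) (f : Config n P → ℝ) :
    meanOf n K P p f
      = meanOf n K P p fun ω => ∑ S, ringWeight K P S * f (Function.update ω.1 j S, ω.2) := by
  simp only [meanOf, weight_eq]
  rw [Fintype.sum_prod_type_right, Fintype.sum_prod_type_right]
  refine Finset.sum_congr rfl fun y _ => ?_
  have h := sum_prod_resample (ringWeight K P) (sum_ringWeight hK) j
    (fun x => (∏ e, channelWeight p (y e)) * f (x, y))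
  simp only [mul_assoc]
  rw [h]
  refine Finset.sum_congr rfl fun x _ => ?_
  simp only [Finset.mul_sum]
  exact Finset.sum_congr rfl fun t _ => by ring

lemma meanOf_resample_channel (e : Sym2 (Fin n)) (f : Config n P → ℝ) :
    meanOf n K P p f
      = meanOf n K P p fun ω => ∑ b, channelWeight p b * f (ω.1, Function.update ω.2 e b) := by
  simp only [meanOf, weight_eq]
  rw [Fintype.sum_prod_type, Fintype.sum_prod_type]
  refine Finset.sum_congr rfl fun x _ => ?_
  have h := sum_prod_resample (channelWeight p) (sum_channelWeight p) e
    (fun y => f (x, y))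
  simp only [mul_assoc, ← Finset.mul_sum]
  rw [h]

/-- Indicator of adjacency (for distinct vertices). -/
noncomputable def adjInd (q : ℕ) (ω : Config n P) (a j : Fin n) : ℝ :=
  if q ≤ (ω.1 a ∩ ω.1 j).card ∧ ω.2 s(a, j) = true then 1 else 0

lemma adjInd_eq (q : ℕ) (ω : Config n P) (a j : Fin n) :
    adjInd q ω a j = shareInd q (ω.1 a) (ω.1 j) * if ω.2 s(a, j) then 1 else 0 := by
  unfold adjInd shareInd
  by_cases h1 : q ≤ (ω.1 a ∩ ω.1 j).card <;> by_cases h2 : ω.2 s(a, j) = true <;> simp [h1, h2]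

lemma meanOf_mul_adjInd {q : ℕ} (hK : K ≤ P) {a j : Fin n} (haj : a ≠ j) (Φ : Config n P → ℝ)
    (hring : ∀ ω S, Φ (Function.update ω.1 j S, ω.2) = Φ ω)
    (hchan : ∀ ω b, Φ (ω.1, Function.update ω.2 s(a, j) b) = Φ ω) :
    meanOf n K P p (fun ω => Φ ω * adjInd q ω a j) = peq q K P p * meanOf n K P p Φ := by
  rw [meanOf_resample_channel s(a, j), meanOf_resample_ring hK j, ← meanOf_const_mul]
  refine meanOf_congr fun ω hω => ?_
  have hr : ∀ (S : Finset (Fin P)) (b : Bool),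
      Φ (Function.update ω.1 j S, Function.update ω.2 s(a, j) b) = Φ ω := fun S b => by
    rw [← hring ω S]
    exact hchan (Function.update ω.1 j S, ω.2) b
  simp only [adjInd_eq, hr, Function.update_self, Function.update_of_ne haj]
  rw [peq, ← sum_ringWeight_shareInd hK (ω.1 a) (hω a)]
  simp only [Finset.mul_sum, Finset.sum_mul, Fintype.sum_bool, channelWeight]
  refine Finset.sum_congr rfl fun S _ => ?_
  simp; ring

lemma meanOf_mul_adjInd_mul_adjInd {q : ℕ} (hK : K ≤ P) {a b j : Fin n} (haj : a ≠ j)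
    (hbj : b ≠ j) (hab : a ≠ b) (Φ : Config n P → ℝ)
    (hring : ∀ ω S, Φ (Function.update ω.1 j S, ω.2) = Φ ω)
    (hchana : ∀ ω c, Φ (ω.1, Function.update ω.2 s(a, j) c) = Φ ω)
    (hchanb : ∀ ω c, Φ (ω.1, Function.update ω.2 s(b, j) c) = Φ ω) :
    meanOf n K P p (fun ω => Φ ω * (adjInd q ω a j * adjInd q ω b j))
      = meanOf n K P p fun ω => Φ ω * (p ^ 2 * jointShare q K P (ω.1 a) (ω.1 b)) := by
  rw [meanOf_resample_channel s(b, j), meanOf_resample_channel s(a, j),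
    meanOf_resample_ring hK j]
  refine meanOf_congr fun ω hω => ?_
  have hr : ∀ (S : Finset (Fin P)) (c d : Bool), Φ (Function.update ω.1 j S,
      Function.update (Function.update ω.2 s(a, j) c) s(b, j) d) = Φ ω := fun S c d => by
    rw [← hring ω S, ← hchana (Function.update ω.1 j S, ω.2) c]
    exact hchanb (Function.update ω.1 j S, Function.update ω.2 s(a, j) c) d
  have hne : s(a, j) ≠ s(b, j) := by
    intro h; rw [Sym2.eq_iff] at h; tauto
  simp only [adjInd_eq, hr, Function.update_self, Function.update_of_ne haj,
    Function.update_of_ne hbj, Function.update_of_ne hne]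
  rw [jointShare]
  simp only [Finset.mul_sum, Fintype.sum_bool, channelWeight]
  refine Finset.sum_congr rfl fun S _ => ?_
  simp; ring

/-- Number of vertices of `J` adjacent to `a`, where `a ∉ J`. -/
def degIn (q : ℕ) (a : Fin n) (J : Finset (Fin n)) (ω : Config n P) : ℕ :=
  (J.filter fun j => q ≤ (ω.1 a ∩ ω.1 j).card ∧ ω.2 s(a, j) = true).card

lemma degIn_update_ring {q : ℕ} {a j : Fin n} {J : Finset (Fin n)} (haj : a ≠ j) (hj : j ∉ J)
    (ω : Config n P) (S : Finset (Fin P)) :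
    degIn q a J (Function.update ω.1 j S, ω.2) = degIn q a J ω := by
  unfold degIn
  congr 1
  refine Finset.filter_congr fun i hi => ?_
  have : i ≠ j := fun h => hj (h ▸ hi)
  simp [Function.update_of_ne haj, Function.update_of_ne this]

lemma degIn_update_channel {q : ℕ} {a b j : Fin n} {J : Finset (Fin n)} (haj : a ≠ j)
    (hj : j ∉ J) (ω : Config n P) (c : Bool) :
    degIn q a J (ω.1, Function.update ω.2 s(b, j) c) = degIn q a J ω := by
  unfold degIn
  congr 1
  refine Finset.filter_congr fun i hi => ?_
  have hij : i ≠ j := fun h => hj (h ▸ hi)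
  have : s(a, i) ≠ s(b, j) := by
    intro h; rw [Sym2.eq_iff] at h; tauto
  simp [Function.update_of_ne this]

/-- Indicator of `N < c`. -/
def ltInd (N c : ℕ) : ℝ := if N < c then 1 else 0

lemma ltInd_nonneg (N c : ℕ) : 0 ≤ ltInd N c := by unfold ltInd; split_ifs <;> norm_num

lemma ltInd_le_one (N c : ℕ) : ltInd N c ≤ 1 := by unfold ltInd; split_ifs <;> norm_num

lemma ltInd_pred_le (N c : ℕ) : ltInd N (c - 1) ≤ ltInd N c := by
  unfold ltInd; split_ifs <;> first | omega | norm_num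

lemma ltInd_degIn_insert {q : ℕ} {a j : Fin n} {J : Finset (Fin n)} (hj : j ∉ J)
    (ω : Config n P) (c : ℕ) :
    ltInd (degIn q a (insert j J) ω) c = (1 - adjInd q ω a j) * ltInd (degIn q a J ω) c
      + adjInd q ω a j * ltInd (degIn q a J ω) (c - 1) := by
  unfold degIn adjInd
  rw [Finset.filter_insert]
  split_ifs with h
  · rw [card_insert_of_notMem (by simp [hj])]
    simp only [ltInd, sub_self, zero_mul, one_mul, zero_add]
    congr 1
    exact propext (by omega)
  · simp

/-- `binomLt x m c` is the probability that a binomial variable with parameters `m` and `x` is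
smaller than `c`. -/
noncomputable def binomLt (x : ℝ) : ℕ → ℕ → ℝ
  | 0, c => ltInd 0 c
  | m + 1, c => (1 - x) * binomLt x m c + x * binomLt x m (c - 1)

lemma meanOf_ltInd_degIn {q : ℕ} (hK : K ≤ P) (a : Fin n) (J : Finset (Fin n)) :
    a ∉ J → ∀ c, meanOf n K P p (fun ω => ltInd (degIn q a J ω) c)
      = binomLt (peq q K P p) J.card c := by
  induction J using Finset.induction_on with
  | empty =>
    intro _ c
    simp only [degIn, filter_empty, card_empty, binomLt]
    have := meanOf_const_mul (n := n) (K := K) (P := P) (p := p) (ltInd 0 c) (fun _ => 1)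
    simpa [meanOf_one hK] using this
  | insert j J hj ih =>
    intro ha c
    rw [mem_insert, not_or] at ha
    have hstep : ∀ c, meanOf n K P p
        (fun ω => ltInd (degIn q a J ω) c * adjInd q ω a j)
        = peq q K P p * meanOf n K P p (fun ω => ltInd (degIn q a J ω) c) := fun c =>
      meanOf_mul_adjInd hK ha.1 _ (fun ω S => by rw [degIn_update_ring ha.1 hj])
        (fun ω b => by rw [degIn_update_channel ha.1 hj])
    rw [card_insert_of_notMem hj, binomLt, ← ih ha.2 c, ← ih ha.2 (c - 1), sub_mul, one_mul,
      ← hstep c, ← hstep (c - 1), ← meanOf_sub, ← meanOf_add]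
    refine meanOf_congr fun ω _ => ?_
    rw [ltInd_degIn_insert hj]; ring

/-- Per-vertex cost of treating the degrees of two vertices with rings `S`, `T` as independent. -/
noncomputable def decouplingFactor (q K P : ℕ) (p : ℝ) (S T : Finset (Fin P)) : ℝ :=
  1 + (peq q K P p ^ 2 + 2 * (p ^ 2 * jointShare q K P S T)) / (1 - peq q K P p) ^ 2

lemma decouplingFactor_one_le (q K P : ℕ) (p : ℝ) (S T : Finset (Fin P)) :
    1 ≤ decouplingFactor q K P p S T := by
  have := jointShare_nonneg q K P S T
  unfold decouplingFactor
  have : 0 ≤ (peq q K P p ^ 2 + 2 * (p ^ 2 * jointShare q K P S T)) / (1 - peq q K P p) ^ 2 := by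
    positivity
  linarith

lemma meanOf_ltInd_mul_ltInd_le {q : ℕ} (hp : p ∈ Set.Icc (0 : ℝ) 1) (hK : K ≤ P)
    (hx0 : 0 ≤ peq q K P p) (hx1 : peq q K P p < 1)
    {a b : Fin n} (hab : a ≠ b) (J : Finset (Fin n)) :
    a ∉ J → b ∉ J → ∀ (c d : ℕ) (φ : Finset (Fin P) → Finset (Fin P) → ℝ), (∀ S T, 0 ≤ φ S T) →
      meanOf n K P p (fun ω => φ (ω.1 a) (ω.1 b)
          * (ltInd (degIn q a J ω) c * ltInd (degIn q b J ω) d))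
        ≤ meanOf n K P p (fun ω => φ (ω.1 a) (ω.1 b)
            * decouplingFactor q K P p (ω.1 a) (ω.1 b) ^ J.card)
          * (binomLt (peq q K P p) J.card c * binomLt (peq q K P p) J.card d) := by
  induction J using Finset.induction_on with
  | empty =>
    intro _ _ c d φ _
    simp only [degIn, filter_empty, card_empty, binomLt, pow_zero, mul_one]
    rw [mul_comm (meanOf _ _ _ _ _), ← meanOf_const_mul]
    exact le_of_eq (meanOf_congr fun ω _ => by ring)
  | insert j J hj ih =>
    intro ha hb c d φ hφ
    rw [mem_insert, not_or] at ha hb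
    set x := peq q K P p with hx
    set L := fun ω : Config n P => decouplingFactor q K P p (ω.1 a) (ω.1 b) with hL
    set j2 := fun ω : Config n P => p ^ 2 * jointShare q K P (ω.1 a) (ω.1 b) with hj2
    set f := fun ω : Config n P => φ (ω.1 a) (ω.1 b) with hf
    set I := fun (c d : ℕ) (ω : Config n P) =>
      ltInd (degIn q a J ω) c * ltInd (degIn q b J ω) d with hI
    have hring : ∀ c d ω S, f (Function.update ω.1 j S, ω.2) * I c d (Function.update ω.1 j S, ω.2)
        = f ω * I c d ω := fun c d ω S => by
      simp only [hf, hI, degIn_update_ring ha.1 hj, degIn_update_ring hb.1 hj,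
        Function.update_of_ne ha.1, Function.update_of_ne hb.1]
    have hchan : ∀ v c d ω s, f (ω.1, Function.update ω.2 s(v, j) s)
        * I c d (ω.1, Function.update ω.2 s(v, j) s) = f ω * I c d ω := fun v c d ω s => by
      simp only [hf, hI, degIn_update_channel ha.1 hj, degIn_update_channel hb.1 hj]
    have hsa : ∀ c d, meanOf n K P p (fun ω => f ω * I c d ω * adjInd q ω a j)
        = x * meanOf n K P p (fun ω => f ω * I c d ω) := fun c d =>
      meanOf_mul_adjInd hK ha.1 _ (hring c d) (hchan a c d)
    have hsb : ∀ c d, meanOf n K P p (fun ω => f ω * I c d ω * adjInd q ω b j)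
        = x * meanOf n K P p (fun ω => f ω * I c d ω) := fun c d =>
      meanOf_mul_adjInd hK hb.1 _ (hring c d) (hchan b c d)
    have hsab : ∀ c d, meanOf n K P p
        (fun ω => f ω * I c d ω * (adjInd q ω a j * adjInd q ω b j))
        = meanOf n K P p (fun ω => f ω * I c d ω * j2 ω) := fun c d =>
      meanOf_mul_adjInd_mul_adjInd hK ha.1 hb.1 hab _ (hring c d) (hchan a c d) (hchan b c d)
    have hih : ∀ c d, meanOf n K P p (fun ω => f ω * L ω * I c d ω)
        ≤ meanOf n K P p (fun ω => f ω * L ω ^ (J.card + 1))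
          * (binomLt x J.card c * binomLt x J.card d) := by
      intro c d
      have := ih ha.2 hb.2 c d (fun S T => φ S T * decouplingFactor q K P p S T)
        (fun S T => mul_nonneg (hφ S T)
          (zero_le_one.trans (decouplingFactor_one_le q K P p S T)))
      simpa only [hf, hL, hI, pow_succ', mul_assoc] using this
    have hexp : meanOf n K P p (fun ω => f ω
          * (ltInd (degIn q a (insert j J) ω) c * ltInd (degIn q b (insert j J) ω) d))
        = meanOf n K P p (fun ω => f ω * ((1 - 2 * x + j2 ω) * I c d ω
            + (x - j2 ω) * (I (c - 1) d ω + I c (d - 1) ω) + j2 ω * I (c - 1) (d - 1) ω)) := by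
      have e1 : meanOf n K P p (fun ω => f ω
          * (ltInd (degIn q a (insert j J) ω) c * ltInd (degIn q b (insert j J) ω) d))
          = meanOf n K P p (fun ω => f ω * I c d ω)
            - meanOf n K P p (fun ω => f ω * I c d ω * adjInd q ω a j)
            - meanOf n K P p (fun ω => f ω * I c d ω * adjInd q ω b j)
            + meanOf n K P p (fun ω => f ω * I c d ω * (adjInd q ω a j * adjInd q ω b j))
            + (meanOf n K P p (fun ω => f ω * I (c - 1) d ω * adjInd q ω a j)
              - meanOf n K P p
                (fun ω => f ω * I (c - 1) d ω * (adjInd q ω a j * adjInd q ω b j)))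
            + (meanOf n K P p (fun ω => f ω * I c (d - 1) ω * adjInd q ω b j)
              - meanOf n K P p
                (fun ω => f ω * I c (d - 1) ω * (adjInd q ω a j * adjInd q ω b j)))
            + meanOf n K P p
              (fun ω => f ω * I (c - 1) (d - 1) ω * (adjInd q ω a j * adjInd q ω b j)) := by
        simp only [← meanOf_sub, ← meanOf_add]
        refine meanOf_congr fun ω _ => ?_
        rw [ltInd_degIn_insert hj, ltInd_degIn_insert hj]
        simp only [hI]; ring
      rw [e1]
      simp only [hsa, hsb, hsab]
      simp only [← meanOf_const_mul, ← meanOf_sub, ← meanOf_add]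
      exact meanOf_congr fun ω _ => by ring
    have hbound : ∀ ω : Config n P, f ω * ((1 - 2 * x + j2 ω) * I c d ω
            + (x - j2 ω) * (I (c - 1) d ω + I c (d - 1) ω) + j2 ω * I (c - 1) (d - 1) ω)
        ≤ (1 - x) ^ 2 * (f ω * L ω * I c d ω)
          + x * (1 - x) * (f ω * L ω * I (c - 1) d ω)
          + x * (1 - x) * (f ω * L ω * I c (d - 1) ω)
          + x ^ 2 * (f ω * L ω * I (c - 1) (d - 1) ω) := by
      intro ω
      have hf0 : 0 ≤ f ω := hφ _ _
      have hj0 : 0 ≤ j2 ω := mul_nonneg (sq_nonneg p) (jointShare_nonneg _ _ _ _ _)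
      have hL1 : 1 ≤ L ω := decouplingFactor_one_le _ _ _ _ _ _
      have hLx : (1 - x) ^ 2 * L ω = (1 - x) ^ 2 + x ^ 2 + 2 * j2 ω := by
        have : (1 - x) ^ 2 ≠ 0 := by
          have : 0 < 1 - x := by linarith
          positivity
        simp only [hL, decouplingFactor, ← hx, hj2]
        rw [mul_add, mul_div_cancel₀ _ this]; ring
      have hI0 : ∀ c d, 0 ≤ I c d ω := fun c d => mul_nonneg (ltInd_nonneg _ _) (ltInd_nonneg _ _)
      have hIa : ∀ d, I (c - 1) d ω ≤ I c d ω := fun d =>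
        mul_le_mul_of_nonneg_right (ltInd_pred_le _ _) (ltInd_nonneg _ _)
      have hIb : ∀ c, I c (d - 1) ω ≤ I c d ω := fun c =>
        mul_le_mul_of_nonneg_left (ltInd_pred_le _ _) (ltInd_nonneg _ _)
      have hx1' : 0 ≤ x * (1 - x) := mul_nonneg hx0 (by linarith)
      have key : (1 - 2 * x + j2 ω) * I c d ω
            + (x - j2 ω) * (I (c - 1) d ω + I c (d - 1) ω) + j2 ω * I (c - 1) (d - 1) ω
          ≤ (1 - x) ^ 2 * L ω * I c d ω + x * (1 - x) * (L ω * I (c - 1) d ω)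
          + x * (1 - x) * (L ω * I c (d - 1) ω) + x ^ 2 * (L ω * I (c - 1) (d - 1) ω) := by
        have g1 : x * (1 - x) * I (c - 1) d ω ≤ x * (1 - x) * (L ω * I (c - 1) d ω) :=
          mul_le_mul_of_nonneg_left (le_mul_of_one_le_left (hI0 _ _) hL1) hx1'
        have g2 : x * (1 - x) * I c (d - 1) ω ≤ x * (1 - x) * (L ω * I c (d - 1) ω) :=
          mul_le_mul_of_nonneg_left (le_mul_of_one_le_left (hI0 _ _) hL1) hx1'
        have g3 : 0 ≤ x ^ 2 * (L ω * I (c - 1) (d - 1) ω) :=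
          mul_nonneg (sq_nonneg x) (mul_nonneg (by linarith) (hI0 _ _))
        have g4 : j2 ω * I (c - 1) (d - 1) ω ≤ j2 ω * I c d ω :=
          mul_le_mul_of_nonneg_left ((hIa _).trans (hIb _)) hj0
        have g5 : x ^ 2 * I (c - 1) d ω ≤ x ^ 2 * I c d ω :=
          mul_le_mul_of_nonneg_left (hIa _) (sq_nonneg x)
        have g6 : x ^ 2 * I c (d - 1) ω ≤ x ^ 2 * I c d ω :=
          mul_le_mul_of_nonneg_left (hIb _) (sq_nonneg x)
        have g7 := mul_nonneg hj0 (hI0 (c - 1) d)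
        have g8 := mul_nonneg hj0 (hI0 c (d - 1))
        rw [hLx]
        nlinarith
      calc _ ≤ f ω * ((1 - x) ^ 2 * L ω * I c d ω + x * (1 - x) * (L ω * I (c - 1) d ω)
          + x * (1 - x) * (L ω * I c (d - 1) ω) + x ^ 2 * (L ω * I (c - 1) (d - 1) ω)) :=
            mul_le_mul_of_nonneg_left key hf0
        _ = _ := by ring
    rw [card_insert_of_notMem hj]
    calc _ = _ := hexp
      _ ≤ _ := meanOf_mono hp hbound
      _ = (1 - x) ^ 2 * meanOf n K P p (fun ω => f ω * L ω * I c d ω)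
          + x * (1 - x) * meanOf n K P p (fun ω => f ω * L ω * I (c - 1) d ω)
          + x * (1 - x) * meanOf n K P p (fun ω => f ω * L ω * I c (d - 1) ω)
          + x ^ 2 * meanOf n K P p (fun ω => f ω * L ω * I (c - 1) (d - 1) ω) := by
        simp only [← meanOf_const_mul, ← meanOf_add]
      _ ≤ (1 - x) ^ 2 * (meanOf n K P p (fun ω => f ω * L ω ^ (J.card + 1))
            * (binomLt x J.card c * binomLt x J.card d))
          + x * (1 - x) * (meanOf n K P p (fun ω => f ω * L ω ^ (J.card + 1))
            * (binomLt x J.card (c - 1) * binomLt x J.card d))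
          + x * (1 - x) * (meanOf n K P p (fun ω => f ω * L ω ^ (J.card + 1))
            * (binomLt x J.card c * binomLt x J.card (d - 1)))
          + x ^ 2 * (meanOf n K P p (fun ω => f ω * L ω ^ (J.card + 1))
            * (binomLt x J.card (c - 1) * binomLt x J.card (d - 1))) := by
        have h1x : 0 ≤ 1 - x := by linarith
        gcongr <;> exact hih _ _
      _ = _ := by rw [binomLt, binomLt]; ring

end Expectation

section SecondMoment

variable {n K P : ℕ} {p : ℝ}

lemma degree_eq_degIn (q : ℕ) (ω : Config n P) (i : Fin n) :
    degree q n P ω i = degIn q i (univ.erase i) ω := by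
  classical
  unfold degree degIn
  rw [Nat.card_eq_fintype_card, Fintype.card_subtype]
  congr 1
  ext j
  have := ne_comm (a := i) (b := j)
  simp only [mem_filter, mem_univ, true_and, mem_erase, and_true]
  simp only [Adj]
  tauto

lemma degIn_mono {q : ℕ} {i : Fin n} {J J' : Finset (Fin n)} (h : J ⊆ J') (ω : Config n P) :
    degIn q i J ω ≤ degIn q i J' ω :=
  card_le_card (filter_subset_filter _ h)

lemma ltInd_anti {N N' : ℕ} (h : N ≤ N') (c : ℕ) : ltInd N' c ≤ ltInd N c := by
  unfold ltInd; split_ifs <;> first | omega | norm_num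

lemma binomLt_nonneg {x : ℝ} (hx : x ∈ Set.Icc (0 : ℝ) 1) (m : ℕ) :
    ∀ c, 0 ≤ binomLt x m c := by
  induction m with
  | zero => exact fun c => ltInd_nonneg 0 c
  | succ m ih =>
    intro c
    exact add_nonneg (mul_nonneg (by linarith [hx.2]) (ih c)) (mul_nonneg hx.1 (ih _))

lemma one_sub_mul_binomLt_le {x : ℝ} (hx : x ∈ Set.Icc (0 : ℝ) 1) (m c : ℕ) :
    (1 - x) * binomLt x m c ≤ binomLt x (m + 1) c :=
  le_add_of_nonneg_right (mul_nonneg hx.1 (binomLt_nonneg hx m _))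

lemma one_sub_pow_le_binomLt {x : ℝ} (hx : x ∈ Set.Icc (0 : ℝ) 1) (m : ℕ) {c : ℕ} (hc : 1 ≤ c) :
    (1 - x) ^ m ≤ binomLt x m c := by
  induction m with
  | zero => simp [binomLt, ltInd, Nat.lt_of_succ_le hc]
  | succ m ih =>
    refine le_trans ?_ (one_sub_mul_binomLt_le hx m c)
    rw [pow_succ']
    exact mul_le_mul_of_nonneg_left ih (by linarith [hx.2])

lemma choose_mul_le_binomLt {x : ℝ} (hx : x ∈ Set.Icc (0 : ℝ) 1) (m : ℕ) :
    ∀ c, (m.choose c : ℝ) * x ^ c * (1 - x) ^ m ≤ binomLt x m (c + 1) := by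
  have h1x : 0 ≤ 1 - x := by linarith [hx.2]
  induction m with
  | zero => intro c; cases c <;> simp [binomLt, ltInd]
  | succ m ih =>
    intro c
    cases c with
    | zero => simpa using one_sub_pow_le_binomLt hx (m + 1) le_rfl
    | succ c =>
      have h1 := mul_le_mul_of_nonneg_left (ih (c + 1)) h1x
      have h2 := mul_le_mul_of_nonneg_left (ih c) hx.1
      have h3 : (m.choose c : ℝ) * x ^ (c + 1) * (1 - x) ^ (m + 1)
          ≤ x * (m.choose c * x ^ c * (1 - x) ^ m) := by
        have : 0 ≤ x * (m.choose c * x ^ c * (1 - x) ^ m) :=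
          mul_nonneg hx.1 (mul_nonneg (mul_nonneg (Nat.cast_nonneg _) (pow_nonneg hx.1 _))
            (pow_nonneg h1x _))
        calc _ = (1 - x) * (x * (m.choose c * x ^ c * (1 - x) ^ m)) := by ring
          _ ≤ _ := mul_le_of_le_one_left this (by linarith [hx.1])
      rw [binomLt, Nat.choose_succ_succ]
      push_cast
      calc _ = (1 - x) * (m.choose (c + 1) * x ^ (c + 1) * (1 - x) ^ m)
            + m.choose c * x ^ (c + 1) * (1 - x) ^ (m + 1) := by ring
        _ ≤ _ := add_le_add h1 (h3.trans h2)

lemma prob_le_of_pair_bound {q k : ℕ} (hp : p ∈ Set.Icc (0 : ℝ) 1) (hK : K ≤ P) (hn : 2 ≤ n)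
    (hx0 : 0 ≤ peq q K P p) (hx1 : peq q K P p < 1)
    (hG : 0 < binomLt (peq q K P p) (n - 1) k) {Λ : ℝ}
    (hΛ : ∀ a b : Fin n, a ≠ b → meanOf n K P p
      (fun ω => decouplingFactor q K P p (ω.1 a) (ω.1 b) ^ (n - 2)) ≤ Λ) :
    prob n K P p {ω | k ≤ minDeg q n P ω}
      ≤ 1 / (n * binomLt (peq q K P p) (n - 1) k) + (Λ / (1 - peq q K P p) ^ 2 - 1) := by
  classical
  set x := peq q K P p with hx
  set G := binomLt x (n - 1) k with hGdef
  have hxI : x ∈ Set.Icc (0 : ℝ) 1 := ⟨hx0, hx1.le⟩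
  have h1x : 0 < 1 - x := by linarith
  have hn0 : (0 : ℝ) < n := by exact_mod_cast (by omega : 0 < n)
  set I := fun (i : Fin n) (ω : Config n P) => ltInd (degIn q i (univ.erase i) ω) k with hI
  set X := fun ω : Config n P => ∑ i, I i ω with hX
  have hEI : ∀ i, meanOf n K P p (I i) = G := fun i => by
    rw [hI, meanOf_ltInd_degIn hK i _ (notMem_erase _ _), card_erase_of_mem (mem_univ _)]
    simp [hGdef, hx]
  have hEX : meanOf n K P p X = n * G := by
    rw [hX, meanOf_sum]; simp [hEI]
  have hG2 : binomLt x (n - 2) k ≤ G / (1 - x) := by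
    rw [le_div_iff₀ h1x, mul_comm]
    have := one_sub_mul_binomLt_le hxI (n - 2) k
    rwa [show n - 2 + 1 = n - 1 by omega] at this
  have hΛ0 : 0 ≤ Λ := by
    refine le_trans ?_ (hΛ ⟨0, by omega⟩ ⟨1, by omega⟩ (by simp))
    exact Finset.sum_nonneg fun ω _ => mul_nonneg (weight_nonneg hp ω)
      (pow_nonneg (zero_le_one.trans (decouplingFactor_one_le _ _ _ _ _ _)) _)
  have hpair : ∀ i j, i ≠ j → meanOf n K P p (fun ω => I i ω * I j ω)
      ≤ Λ * (G / (1 - x)) ^ 2 := by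
    intro i j hij
    set J := (univ.erase i).erase j with hJ
    have hiJ : i ∉ J := by simp [hJ]
    have hjJ : j ∉ J := by simp [hJ]
    have hJc : J.card = n - 2 := by
      rw [hJ, card_erase_of_mem (by simp [hij.symm]), card_erase_of_mem (mem_univ _)]
      simp; omega
    have h1 := meanOf_ltInd_mul_ltInd_le hp hK hx0 hx1 hij J hiJ hjJ k k (fun _ _ => 1)
      (fun _ _ => zero_le_one)
    simp only [one_mul, hJc] at h1
    refine (meanOf_mono hp fun ω => ?_).trans (h1.trans ?_)
    · refine mul_le_mul (ltInd_anti (degIn_mono (erase_subset _ _) ω) k)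
        (ltInd_anti (degIn_mono (fun v hv => ?_) ω) k) (ltInd_nonneg _ _) (ltInd_nonneg _ _)
      exact mem_erase.2 ⟨(mem_erase.1 hv).1, mem_univ _⟩
    · have hb := binomLt_nonneg hxI (n - 2) k
      rw [← sq]
      exact mul_le_mul (hΛ i j hij) (pow_le_pow_left₀ hb hG2 2) (sq_nonneg _) hΛ0
  have hEX2 : meanOf n K P p (fun ω => X ω ^ 2) ≤ n * G + n ^ 2 * (Λ * (G / (1 - x)) ^ 2) := by
    have h1 : meanOf n K P p (fun ω => X ω ^ 2)
        = ∑ i, ∑ j, meanOf n K P p (fun ω => I i ω * I j ω) := by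
      rw [← Finset.sum_congr rfl fun i _ => meanOf_sum univ fun j ω => I i ω * I j ω,
        ← meanOf_sum]
      exact meanOf_congr fun ω _ => by rw [hX, sq, Finset.sum_mul_sum]
    have hR : 0 ≤ Λ * (G / (1 - x)) ^ 2 := by positivity
    have h2 : ∀ i j, meanOf n K P p (fun ω => I i ω * I j ω)
        ≤ (if i = j then G else 0) + Λ * (G / (1 - x)) ^ 2 := by
      intro i j
      split_ifs with hij
      · subst hij
        refine ((meanOf_mono hp fun ω => ?_).trans (hEI i).le).trans (le_add_of_nonneg_right hR)
        exact mul_le_of_le_one_left (ltInd_nonneg _ _) (ltInd_le_one _ _)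
      · rw [zero_add]; exact hpair i j hij
    rw [h1]
    refine (Finset.sum_le_sum fun i _ => Finset.sum_le_sum fun j _ => h2 i j).trans (le_of_eq ?_)
    simp [Finset.sum_add_distrib]
    ring
  have hzero : ∀ ω, k ≤ minDeg q n P ω → X ω = 0 := by
    intro ω hω
    refine Finset.sum_eq_zero fun i _ => ?_
    have : minDeg q n P ω ≤ degree q n P ω i := Nat.sInf_le ⟨i, rfl⟩
    rw [degree_eq_degIn] at this
    simp only [hI, ltInd]
    rw [if_neg (by omega)]
  have hcheb : prob n K P p {ω | k ≤ minDeg q n P ω} * (n * G) ^ 2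
      ≤ meanOf n K P p (fun ω => (X ω - n * G) ^ 2) := by
    rw [prob, Finset.sum_mul, meanOf]
    refine Finset.sum_le_sum fun ω _ => ?_
    by_cases hω : ω ∈ {ω | k ≤ minDeg q n P ω}
    · rw [Set.indicator_of_mem hω, hzero ω hω]
      exact le_of_eq (by ring)
    · rw [Set.indicator_of_notMem hω, zero_mul]
      exact mul_nonneg (weight_nonneg hp ω) (sq_nonneg _)
  have hvar : meanOf n K P p (fun ω => (X ω - n * G) ^ 2)
      = meanOf n K P p (fun ω => X ω ^ 2) - (n * G) ^ 2 := by
    have : meanOf n K P p (fun ω => (X ω - n * G) ^ 2)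
        = meanOf n K P p (fun ω => X ω ^ 2) - 2 * (n * G) * meanOf n K P p X
          + (n * G) ^ 2 * meanOf n K P p (fun _ => 1) := by
      simp only [← meanOf_const_mul, ← meanOf_sub, ← meanOf_add]
      exact meanOf_congr fun ω _ => by ring
    rw [this, hEX, meanOf_one hK]; ring
  have hμ : 0 < (n * G) ^ 2 := by positivity
  rw [← mul_le_mul_iff_left₀ hμ]
  refine hcheb.trans ?_
  rw [hvar]
  have : (1 / (n * G) + (Λ / (1 - x) ^ 2 - 1)) * (n * G) ^ 2
      = n * G + n ^ 2 * (Λ * (G / (1 - x)) ^ 2) - (n * G) ^ 2 := by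
    field_simp
    ring
  rw [this]
  linarith

lemma meanOf_decouplingFactor_pow_le {q m : ℕ} (hq : 1 ≤ q) (hK1 : 1 ≤ K)
    (hp : p ∈ Set.Icc (0 : ℝ) 1) (hK : K ≤ P) (hm : m ≤ n) (hx1 : peq q K P p ≤ 1 / 4)
    {a b : Fin n} (hab : a ≠ b) :
    meanOf n K P p (fun ω => decouplingFactor q K P p (ω.1 a) (ω.1 b) ^ m)
      ≤ Real.exp (n * (2 * peq q K P p ^ 2 + 4 * (p ^ 2 * ((K : ℝ) ^ 2 / P) ^ (2 * q)))
        + (K : ℝ) ^ 2 / P * Real.exp (4 * n * p ^ 2 * ((K : ℝ) ^ 2 / P) ^ q / K)) := by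
  set x := peq q K P p with hx
  set ε := (K : ℝ) ^ 2 / P with hε
  set β := 4 * n * p ^ 2 * ε ^ q / K with hβ
  set A := n * (2 * x ^ 2 + 4 * (p ^ 2 * ε ^ (2 * q))) with hA
  have hε0 : 0 ≤ ε := by positivity
  have hβ0 : 0 ≤ β := by positivity
  have hdec : ∀ S T : Finset (Fin P), S.card = K → T.card = K →
      decouplingFactor q K P p S T ^ m ≤ Real.exp A * Real.exp (β * (S ∩ T).card) := by
    intro S T hS hT
    have hJ := jointShare_le hq hK1 hK S T hS hT
    have hJ0 := jointShare_nonneg q K P S T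
    set Y := 2 * x ^ 2 + 4 * (p ^ 2 * jointShare q K P S T) with hY
    have hY0 : 0 ≤ Y := by positivity
    have hd : decouplingFactor q K P p S T ≤ 1 + Y := by
      have h1 : (1 / 2 : ℝ) ≤ (1 - x) ^ 2 := by nlinarith
      rw [decouplingFactor, ← hx]
      gcongr
      rw [div_le_iff₀ (by linarith)]
      calc _ = Y * (1 / 2) := by rw [hY]; ring
        _ ≤ _ := mul_le_mul_of_nonneg_left h1 hY0
    have hmn : (m : ℝ) ≤ n := by exact_mod_cast hm
    calc decouplingFactor q K P p S T ^ m ≤ (Real.exp Y) ^ m := by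
          refine pow_le_pow_left₀ (zero_le_one.trans (decouplingFactor_one_le _ _ _ _ _ _)) ?_ m
          linarith [Real.add_one_le_exp Y]
      _ = Real.exp (m * Y) := (Real.exp_nat_mul _ _).symm
      _ ≤ Real.exp (n * (2 * x ^ 2 + 4 * (p ^ 2 * (ε ^ (2 * q) + ε ^ q * ((S ∩ T).card / K))))) := by
          refine Real.exp_le_exp.2 (mul_le_mul hmn ?_ hY0 (Nat.cast_nonneg n))
          rw [hY]; gcongr
      _ = _ := by rw [← Real.exp_add]; congr 1; rw [hA, hβ]; ring
  calc meanOf n K P p (fun ω => decouplingFactor q K P p (ω.1 a) (ω.1 b) ^ m)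
      = meanOf n K P p (fun ω => if (ω.1 a).card = K ∧ (ω.1 b).card = K then
          decouplingFactor q K P p (ω.1 a) (ω.1 b) ^ m else 0) :=
        meanOf_congr fun ω hω => by simp [hω]
    _ ≤ meanOf n K P p (fun ω => Real.exp A * Real.exp (β * (ω.1 a ∩ ω.1 b).card)) := by
        refine meanOf_mono hp fun ω => ?_
        split_ifs with h
        · exact hdec _ _ h.1 h.2
        · positivity
    _ = Real.exp A * meanOf n K P p (fun ω => Real.exp (β * (ω.1 a ∩ ω.1 b).card)) :=
        meanOf_const_mul _ _
    _ = Real.exp A * meanOf n K P p (fun ω => ∑ T, ringWeight K P T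
          * Real.exp (β * (ω.1 a ∩ T).card)) := by
        rw [meanOf_resample_ring hK b]
        simp only [Function.update_self, Function.update_of_ne hab]
    _ = Real.exp A * meanOf n K P p (fun ω => if (ω.1 a).card = K then ∑ T, ringWeight K P T
          * Real.exp (β * (ω.1 a ∩ T).card) else 0) := by
        congr 1
        exact meanOf_congr fun ω hω => by simp [hω]
    _ ≤ Real.exp A * meanOf n K P p (fun _ => Real.exp (ε * Real.exp β) * 1) := by
        gcongr
        refine meanOf_mono hp fun ω => ?_
        split_ifs with h
        · rw [mul_one]
          exact sum_ringWeight_exp_inter_le hK1 hK _ h hβ0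
        · positivity
    _ = _ := by rw [meanOf_const_mul, meanOf_one hK, mul_one, ← Real.exp_add]

end SecondMoment

lemma exp_neg_le_one_sub {x : ℝ} (hx1 : x ≤ 1 / 2) :
    Real.exp (-x - 2 * x ^ 2) ≤ 1 - x := by
  have h1 : 0 < 1 - x := by linarith
  rw [← Real.le_log_iff_exp_le h1]
  refine le_trans ?_ (Real.one_sub_inv_le_log_of_pos h1)
  have : (1 - x)⁻¹ ≤ 1 + x + 2 * x ^ 2 := by
    rw [inv_le_iff_one_le_mul₀ h1]
    nlinarith [mul_nonneg (sq_nonneg x) (by linarith : 0 ≤ 1 - 2 * x)]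
  linarith

lemma min_le_mul_binomLt {n r : ℕ} {x a : ℝ} (hn : 2 * r + 2 ≤ n) (hx0 : 0 ≤ x)
    (hx1 : x ≤ 1 / 2) (hnx : n * x ^ 2 ≤ 1 / 2) (hL : 0 < Real.log n)
    (hx : n * x = Real.log n + r * Real.log (Real.log n) + a) :
    min (Real.exp (-1) * Real.exp (Real.log n / 2))
      (Real.exp (-1) * Real.exp (-a) / (4 ^ r * r.factorial))
      ≤ n * binomLt x (n - 1) (r + 1) := by
  have hn0 : (0 : ℝ) < n := by exact_mod_cast (by omega : 0 < n)
  have hxI : x ∈ Set.Icc (0 : ℝ) 1 := ⟨hx0, by linarith⟩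
  have hpow : Real.exp (-1) * Real.exp (-(n * x)) ≤ (1 - x) ^ (n - 1) := by
    calc Real.exp (-1) * Real.exp (-(n * x)) ≤ Real.exp (n * (-x - 2 * x ^ 2)) := by
          rw [← Real.exp_add]; refine Real.exp_le_exp.2 ?_; nlinarith
      _ = Real.exp (-x - 2 * x ^ 2) ^ n := Real.exp_nat_mul _ _
      _ ≤ (1 - x) ^ n := by gcongr; exact exp_neg_le_one_sub hx1
      _ ≤ (1 - x) ^ (n - 1) :=
          pow_le_pow_of_le_one (by linarith) (by linarith) (Nat.sub_le _ _)
  have hnexp : (n : ℝ) = Real.exp (Real.log n) := (Real.exp_log hn0).symm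
  rcases le_total (n * x) (Real.log n / 2) with h | h
  · refine (min_le_left _ _).trans ?_
    calc Real.exp (-1) * Real.exp (Real.log n / 2)
        = Real.exp (Real.log n) * (Real.exp (-1) * Real.exp (-(Real.log n / 2))) := by
          simp only [← Real.exp_add]; congr 1; ring
      _ ≤ n * (Real.exp (-1) * Real.exp (-(n * x))) := by
          rw [← hnexp]; gcongr
      _ ≤ n * binomLt x (n - 1) (r + 1) := by
          gcongr
          exact hpow.trans (one_sub_pow_le_binomLt hxI _ (by omega))
  · refine (min_le_right _ _).trans ?_
    have hch : ((n : ℝ) / 2) ^ r / r.factorial ≤ (n - 1).choose r := by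
      refine le_trans ?_ (Nat.pow_le_choose (α := ℝ) r (n - 1))
      gcongr
      rw [Nat.cast_sub (by omega), show n - 1 + 1 = n by omega]
      have : (2 * r + 2 : ℝ) ≤ n := by exact_mod_cast hn
      linarith
    have hcx : (Real.log n / 4) ^ r / r.factorial ≤ (n - 1).choose r * x ^ r := by
      calc (Real.log n / 4) ^ r / r.factorial ≤ (n * x / 2) ^ r / r.factorial := by
            gcongr ?_ ^ r / _; linarith
        _ = ((n : ℝ) / 2) ^ r / r.factorial * x ^ r := by
            rw [show n * x / 2 = (n / 2) * x by ring, mul_pow]; ring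
        _ ≤ _ := by gcongr
    have hexp : Real.exp (-(n * x)) = Real.exp (-a) / (n * Real.log n ^ r) := by
      have hLr : Real.log n ^ r = Real.exp (r * Real.log (Real.log n)) := by
        rw [Real.exp_nat_mul, Real.exp_log hL]
      rw [eq_div_iff (by positivity), hLr]
      nth_rewrite 2 [hnexp]
      rw [← Real.exp_add, ← Real.exp_add, hx]
      congr 1; ring
    calc Real.exp (-1) * Real.exp (-a) / (4 ^ r * r.factorial)
        = n * ((Real.log n / 4) ^ r / r.factorial * (Real.exp (-1) * Real.exp (-(n * x)))) := by
          rw [hexp, div_pow]; field_simp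
      _ ≤ n * ((n - 1).choose r * x ^ r * (1 - x) ^ (n - 1)) := by gcongr
      _ ≤ _ := by gcongr; exact choose_mul_le_binomLt hxI _ _

lemma tendsto_log_nat : Tendsto (fun n : ℕ => Real.log n) atTop atTop :=
  Real.tendsto_log_atTop.comp tendsto_natCast_atTop_atTop

lemma mul_exp_pow_le {q : ℕ} {c C k ε p x K n : ℝ} (hc : 0 < c) (hk : 0 ≤ k)
    (hε : 0 ≤ ε) (hp : p ∈ Set.Ioc (0 : ℝ) 1) (hn : 1 ≤ n) (hK : 1 ≤ K)
    (hC : C = 4 * k / c) (hKC : 2 * q * C ≤ K)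
    (hxn : n * x ≤ k * Real.log n) (hcx : c * (p * ε ^ q) ≤ x) :
    (ε * Real.exp (4 * n * p ^ 2 * ε ^ q / K)) ^ q
      ≤ ε ^ q * Real.exp (q * C)
        + k / c * (Real.log n ^ 2 * Real.exp (-(Real.log n / 2))) := by
  have hp0 := hp.1
  have hL : 0 ≤ Real.log n := Real.log_nonneg hn
  have hC0 : 0 ≤ C := by rw [hC]; positivity
  set B := 4 * n * p ^ 2 * ε ^ q / K with hB
  have hBle : B ≤ C * (p * Real.log n) / K := by
    rw [hB]
    gcongr ?_ / K
    have h1 : n * (c * (p * ε ^ q)) ≤ k * Real.log n :=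
      (mul_le_mul_of_nonneg_left hcx (by linarith)).trans hxn
    have h2 : n * (p * ε ^ q) ≤ k * Real.log n / c := by
      rw [le_div_iff₀ hc]; linarith
    calc 4 * n * p ^ 2 * ε ^ q = 4 * p * (n * (p * ε ^ q)) := by ring
      _ ≤ 4 * p * (k * Real.log n / c) := by gcongr
      _ = _ := by rw [hC]; ring
  rw [mul_pow, ← Real.exp_nat_mul]
  have hL2 : 0 ≤ k / c * (Real.log n ^ 2 * Real.exp (-(Real.log n / 2))) := by positivity
  have hE : 0 ≤ ε ^ q * Real.exp (q * C) := by positivity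
  rcases le_total (p * Real.log n) 1 with h | h
  · refine le_trans ?_ (le_add_of_nonneg_right hL2)
    gcongr
    refine hBle.trans ?_
    rw [div_le_iff₀ (by linarith)]
    exact mul_le_mul_of_nonneg_left (h.trans hK) hC0
  · refine le_trans ?_ (le_add_of_nonneg_left hE)
    have h1 : ε ^ q ≤ k / c * (Real.log n ^ 2 / n) := by
      have g1 : c * ε ^ q ≤ x * Real.log n := by
        calc c * ε ^ q ≤ c * ε ^ q * (p * Real.log n) := le_mul_of_one_le_right (by positivity) h
          _ = c * (p * ε ^ q) * Real.log n := by ring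
          _ ≤ _ := by gcongr
      have g2 : n * (c * ε ^ q) ≤ k * Real.log n ^ 2 := by
        calc n * (c * ε ^ q) ≤ n * (x * Real.log n) := by gcongr
          _ = n * x * Real.log n := by ring
          _ ≤ k * Real.log n * Real.log n := by gcongr
          _ = _ := by ring
      rw [div_mul_div_comm, le_div_iff₀ (by positivity)]
      linarith
    have h2 : q * B ≤ Real.log n / 2 := by
      calc q * B ≤ q * (C * (p * Real.log n) / K) := by gcongr
        _ ≤ q * (C * (1 * Real.log n) / K) := by gcongr; exact hp.2
        _ = (2 * q * C) / K * (Real.log n / 2) := by ring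
        _ ≤ 1 * (Real.log n / 2) := by
            gcongr
            rw [div_le_one (by linarith)]; exact hKC
        _ = _ := one_mul _
    calc ε ^ q * Real.exp (q * B)
        ≤ k / c * (Real.log n ^ 2 / n) * Real.exp (Real.log n / 2) := by gcongr
      _ = k / c * (Real.log n ^ 2 * (Real.exp (Real.log n / 2) / n)) := by ring
      _ = _ := by
        congr 2
        rw [div_eq_iff (by positivity)]
        nth_rewrite 3 [← Real.exp_log (by linarith : 0 < n)]
        rw [← Real.exp_add]; congr 1; ring

lemma tendsto_zero_of_pow {f : ℕ → ℝ} {q : ℕ} (hq : q ≠ 0) (hf : ∀ n, 0 ≤ f n)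
    (h : Tendsto (fun n => f n ^ q) atTop (nhds 0)) : Tendsto f atTop (nhds 0) := by
  have hq0 : (0 : ℝ) < (q : ℝ)⁻¹ := by positivity
  have := h.rpow_const (p := (q : ℝ)⁻¹) (Or.inr hq0.le)
  rw [Real.zero_rpow hq0.ne'] at this
  exact this.congr fun n => Real.pow_rpow_inv_natCast (hf n) hq

/-- if `K_n → ∞`, `K_n²/P_n → 0` and
`p_{e,q}(n) = (ln n + (k−1) ln ln n + α_n)/n` with `α_n → −∞`, then
`P[min degree of 𝔾_q(n,K_n,P_n,p_n) ≥ k] → 0`. -/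
theorem min_degree_atLeast_k_prob_zero_limit
    (q : ℕ) (hq : 1 ≤ q) (k : ℕ) (hk : 1 ≤ k)
    (K P : ℕ → ℕ) (p : ℕ → ℝ) (α : ℕ → ℝ)
    (hK1 : ∀ n, 1 ≤ K n) (hKP : ∀ n, K n ≤ P n)
    (hp : ∀ n, p n ∈ Set.Ioc (0 : ℝ) 1)
    (hKinf : Tendsto (fun n => (K n : ℝ)) atTop atTop)
    (hKsqP : Tendsto (fun n => ((K n : ℝ)) ^ 2 / (P n : ℝ)) atTop (nhds 0))
    (hpe : ∀ n : ℕ, peq q (K n) (P n) (p n)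
      = (Real.log (n : ℝ) + ((k : ℝ) - 1) * Real.log (Real.log (n : ℝ)) + α n) / (n : ℝ))
    (hα : Tendsto α atTop atBot) :
    Tendsto (fun n => prob n (K n) (P n) (p n) {ω | k ≤ minDeg q n (P n) ω})
      atTop (nhds 0) := by
  have hp' : ∀ n, p n ∈ Set.Icc (0 : ℝ) 1 := fun n => ⟨(hp n).1.le, (hp n).2⟩
  set x := fun n => peq q (K n) (P n) (p n) with hx
  set ε := fun n => (K n : ℝ) ^ 2 / P n with hε
  set c : ℝ := 1 / (2 * 4 ^ q * q.factorial) with hc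
  have hc0 : 0 < c := by positivity
  have hk0 : (0 : ℝ) ≤ k - 1 := by
    have : (1 : ℝ) ≤ k := by exact_mod_cast hk
    linarith
  have hε0 : ∀ n, 0 ≤ ε n := fun n => by positivity
  have hx0 : ∀ n, 0 ≤ x n := fun n => mul_nonneg (hp' n).1 (psq_nonneg (hKP n))
  have hLinf := tendsto_log_nat
  have hnx : ∀ᶠ n : ℕ in atTop, n * x n
      = Real.log n + ((k : ℝ) - 1) * Real.log (Real.log n) + α n := by
    filter_upwards [eventually_ge_atTop 1] with n hn
    have : (n : ℝ) ≠ 0 := by exact_mod_cast (by omega : n ≠ 0)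
    rw [hx]; dsimp only; rw [hpe n]; field_simp
  have hnxle : ∀ᶠ n : ℕ in atTop, n * x n ≤ k * Real.log n := by
    filter_upwards [hnx, hLinf.eventually_ge_atTop 1, hα.eventually_le_atBot 0] with n h1 h2 h3
    rw [h1]
    have : Real.log (Real.log n) ≤ Real.log n := Real.log_le_self (by linarith)
    nlinarith
  have hcx : ∀ᶠ n in atTop, c * (p n * ε n ^ q) ≤ x n := by
    filter_upwards [hKinf.eventually_ge_atTop (2 * q : ℝ),
      hKsqP.eventually_le_const (show (0 : ℝ) < 1 / 4 by norm_num)] with n h1 h2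
    have hP0 : (0 : ℝ) < P n := by exact_mod_cast (hK1 n).trans (hKP n)
    have h3 : 4 * K n ^ 2 ≤ P n := by
      rw [div_le_iff₀ hP0] at h2
      have : (4 * K n ^ 2 : ℝ) ≤ P n := by linarith
      exact_mod_cast this
    have h4 : 2 * K n ^ 2 + 2 * K n ≤ P n := by nlinarith [hK1 n]
    have h5 := le_psq (q := q) (by exact_mod_cast h1) (hK1 n) h4
    calc c * (p n * ε n ^ q) = p n * (c * ε n ^ q) := by ring
      _ ≤ _ := mul_le_mul_of_nonneg_left h5 (hp' n).1
  have hlogn : Tendsto (fun n : ℕ => Real.log n ^ 2 / n) atTop (nhds 0) := by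
    have := (Real.tendsto_pow_log_div_mul_add_atTop 1 0 2 one_ne_zero).comp
      (tendsto_natCast_atTop_atTop (R := ℝ))
    simpa [Function.comp_def] using this
  have hnx2 : Tendsto (fun n : ℕ => n * x n ^ 2) atTop (nhds 0) := by
    have h := hlogn.const_mul ((k : ℝ) ^ 2)
    rw [mul_zero] at h
    refine squeeze_zero' (Eventually.of_forall fun n => by positivity) ?_ h
    filter_upwards [hnxle, eventually_ge_atTop 1] with n h1 h2
    have hn0 : (0 : ℝ) < n := by exact_mod_cast h2
    have h3 : 0 ≤ n * x n := mul_nonneg hn0.le (hx0 n)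
    calc n * x n ^ 2 = (n * x n) ^ 2 / n := by field_simp
      _ ≤ (k * Real.log n) ^ 2 / n := by gcongr
      _ = _ := by ring
  have hxlim : Tendsto x atTop (nhds 0) := by
    have h2 : Tendsto (fun n => x n ^ 2) atTop (nhds 0) := by
      refine squeeze_zero' (Eventually.of_forall fun n => sq_nonneg _) ?_ hnx2
      filter_upwards [eventually_ge_atTop 1] with n h
      exact le_mul_of_one_le_left (sq_nonneg _) (by exact_mod_cast h)
    exact tendsto_zero_of_pow two_ne_zero hx0 h2
  have hpε : Tendsto (fun n : ℕ => n * (p n ^ 2 * ε n ^ (2 * q))) atTop (nhds 0) := by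
    have h := hnx2.const_mul (1 / c ^ 2)
    rw [mul_zero] at h
    refine squeeze_zero' (Eventually.of_forall fun n => by positivity) ?_ h
    filter_upwards [hcx] with n h1
    have h2 : 0 ≤ c * (p n * ε n ^ q) :=
      mul_nonneg hc0.le (mul_nonneg (hp' n).1 (pow_nonneg (hε0 n) _))
    calc n * (p n ^ 2 * ε n ^ (2 * q)) = 1 / c ^ 2 * (n * (c * (p n * ε n ^ q)) ^ 2) := by
          rw [mul_comm 2 q, pow_mul]; field_simp
      _ ≤ _ := by gcongr
  have hεexp : Tendsto (fun n : ℕ =>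
      ε n * Real.exp (4 * n * p n ^ 2 * ε n ^ q / K n)) atTop (nhds 0) := by
    refine tendsto_zero_of_pow (q := q) (by omega) (fun n => by have := hε0 n; positivity) ?_
    have hlim : Tendsto (fun n : ℕ => ε n ^ q * Real.exp (q * (4 * k / c))
        + k / c * (Real.log n ^ 2 * Real.exp (-(Real.log n / 2)))) atTop (nhds 0) := by
      have h1 : Tendsto (fun n => ε n ^ q * Real.exp (q * (4 * k / c))) atTop (nhds 0) := by
        have := (hKsqP.pow q).mul_const (Real.exp (q * (4 * k / c)))
        rwa [zero_pow (by omega), zero_mul] at this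
      have h2 : Tendsto (fun n : ℕ => Real.log n ^ 2 * Real.exp (-(Real.log n / 2)))
          atTop (nhds 0) := by
        have := ((Real.tendsto_pow_mul_exp_neg_atTop_nhds_zero 2).comp
          (hLinf.atTop_div_const (show (0 : ℝ) < 2 by norm_num))).const_mul 4
        rw [mul_zero] at this
        refine this.congr fun n => ?_
        simp only [Function.comp_apply]; ring
      simpa using h1.add (h2.const_mul ((k : ℝ) / c))
    refine squeeze_zero' (Eventually.of_forall fun n => by have := hε0 n; positivity) ?_ hlim
    filter_upwards [hcx, hnxle, eventually_ge_atTop 1,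
      hKinf.eventually_ge_atTop (2 * q * (4 * k / c))] with n h1 h2 h3 h4
    exact mul_exp_pow_le hc0 (Nat.cast_nonneg k) (hε0 n) (hp n) (by exact_mod_cast h3)
      (by exact_mod_cast hK1 n) rfl h4 h2 h1
  have hnG : Tendsto (fun n : ℕ => n * binomLt (x n) (n - 1) k) atTop atTop := by
    obtain ⟨r, rfl⟩ : ∃ r, k = r + 1 := ⟨k - 1, by omega⟩
    have h1 : Tendsto (fun n : ℕ => Real.exp (-1) * Real.exp (Real.log n / 2)) atTop atTop :=
      (Real.tendsto_exp_atTop.comp (hLinf.atTop_div_const (by norm_num))).const_mul_atTop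
        (Real.exp_pos _)
    have h2 : Tendsto (fun n : ℕ => Real.exp (-1) * Real.exp (-α n) / (4 ^ r * r.factorial))
        atTop atTop :=
      ((Real.tendsto_exp_atTop.comp (tendsto_neg_atBot_atTop.comp hα)).const_mul_atTop
        (Real.exp_pos _)).atTop_div_const (by positivity)
    rw [tendsto_atTop]
    intro b
    filter_upwards [h1.eventually_ge_atTop b, h2.eventually_ge_atTop b, hnx,
      hxlim.eventually_le_const (show (0 : ℝ) < 1 / 2 by norm_num),
      hnx2.eventually_le_const (show (0 : ℝ) < 1 / 2 by norm_num),
      hLinf.eventually_gt_atTop 0, eventually_ge_atTop (2 * r + 2)] with n g1 g2 g3 g4 g5 g6 g7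
    refine (le_min g1 g2).trans (min_le_mul_binomLt g7 (hx0 n) g4 g5 g6 ?_)
    rw [g3]; push_cast; ring
  set Λ := fun n : ℕ => Real.exp (n * (2 * x n ^ 2 + 4 * (p n ^ 2 * ε n ^ (2 * q)))
    + ε n * Real.exp (4 * n * p n ^ 2 * ε n ^ q / K n)) with hΛ
  have hΛlim : Tendsto Λ atTop (nhds 1) := by
    have h := ((hnx2.const_mul 2).add (hpε.const_mul 4)).add hεexp
    simp only [mul_zero, add_zero] at h
    have h' := (Real.continuous_exp.tendsto 0).comp h
    rw [Real.exp_zero] at h'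
    refine h'.congr fun n => ?_
    simp only [Function.comp_apply, hΛ]
    congr 2; ring
  have hlim : Tendsto (fun n : ℕ => 1 / (n * binomLt (x n) (n - 1) k)
      + (Λ n / (1 - x n) ^ 2 - 1)) atTop (nhds 0) := by
    have h1 : Tendsto (fun n : ℕ => 1 / (n * binomLt (x n) (n - 1) k)) atTop (nhds 0) := by
      simp only [one_div]; exact hnG.inv_tendsto_atTop
    have h2 := hΛlim.div ((hxlim.const_sub 1).pow 2) (by norm_num)
    simpa using h1.add (h2.sub_const 1)
  refine squeeze_zero' (Eventually.of_forall fun n => ?_) ?_ hlim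
  · exact Finset.sum_nonneg fun ω _ => Set.indicator_nonneg (fun ω _ => weight_nonneg (hp' n) ω) ω
  · filter_upwards [hnG.eventually_gt_atTop 0, eventually_ge_atTop 2,
      hxlim.eventually_le_const (show (0 : ℝ) < 1 / 4 by norm_num)] with n g1 g2 g3
    exact prob_le_of_pair_bound (hp' n) (hKP n) g2 (hx0 n) (by linarith)
      (pos_of_mul_pos_right g1 (Nat.cast_nonneg n)) fun a b hab =>
        meanOf_decouplingFactor_pow_le hq (hK1 n) (hp' n) (hKP n) (Nat.sub_le _ _) g3 hab
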